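/- Let Q be an automorphic loop, i.e., a loop in which all inner mapping generators are multiplicative: T(u·v,x) = T(u,x)·T(v,x), L(u·v,x,y) = L(u,x,y)·L(v,x,y) and R(u·v,x,y) = R(u,x,y)·R(v,x,y) for all u,v,x,y. If Q is an AIM loop, then every associator and every commutator of Q lies in the nucleus N(Q), and every associator lies in the commutant; that is, for all x,y,z,u,v in Q: [[x,y,z],u,v] = [u,[x,y,z],v] = [u,v,[x,y,z]] = 1, [[x,y],z,u] = [z,[x,y],u] = [z,u,[x,y]] = 1, and [[x,y,z],u] = 1. (Equivalently, Q/N(Q) is an abelian group and Q/Z(Q) is a group.) -/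

import Mathlib

/-- A loop: a set with multiplication, left division, right division and identity. -/
structure LoopStr (Q : Type*) where
  mul : Q → Q → Q
  ld : Q → Q → Q
  rd : Q → Q → Q
  one : Q
  one_mul : ∀ x, mul one x = x
  mul_one : ∀ x, mul x one = x
  ld_mul : ∀ x y, ld x (mul x y) = y
  mul_ld : ∀ x y, mul x (ld x y) = y
  rd_mul : ∀ x y, rd (mul x y) y = x
  mul_rd : ∀ x y, mul (rd x y) y = x

namespace LoopStr

variable {Q : Type*}

/-- The associator `[x,y,z] = (x·(y·z)) \ ((x·y)·z)`. -/
def assoc (L : LoopStr Q) (x y z : Q) : Q :=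
  L.ld (L.mul x (L.mul y z)) (L.mul (L.mul x y) z)

/-- The commutator `[x,y] = (y·x) \ (x·y)`. -/
def comm (L : LoopStr Q) (x y : Q) : Q :=
  L.ld (L.mul y x) (L.mul x y)

/-- `T(u,x) = x \ (u·x)`. -/
def Tm (L : LoopStr Q) (u x : Q) : Q := L.ld x (L.mul u x)

/-- `L(u,x,y) = (y·x) \ (y·(x·u))`. -/
def Lm (L : LoopStr Q) (u x y : Q) : Q :=
  L.ld (L.mul y x) (L.mul y (L.mul x u))

/-- `R(u,x,y) = ((u·x)·y) / (x·y)`. -/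
def Rm (L : LoopStr Q) (u x y : Q) : Q :=
  L.rd (L.mul (L.mul u x) y) (L.mul x y)

/-- The six AIM identities: the inner mapping generators commute. -/
def IsAIM (L : LoopStr Q) : Prop :=
  (∀ u x y, L.Tm (L.Tm u x) y = L.Tm (L.Tm u y) x) ∧
  (∀ u x y z w, L.Lm (L.Lm u x y) z w = L.Lm (L.Lm u z w) x y) ∧
  (∀ u x y z w, L.Rm (L.Rm u x y) z w = L.Rm (L.Rm u z w) x y) ∧
  (∀ u x y z, L.Tm (L.Lm u x y) z = L.Lm (L.Tm u z) x y) ∧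
  (∀ u x y z, L.Tm (L.Rm u x y) z = L.Rm (L.Tm u z) x y) ∧
  (∀ u x y z w, L.Lm (L.Rm u x y) z w = L.Rm (L.Lm u z w) x y)

/-- Membership in the nucleus `N(Q)`. -/
def inNucleus (L : LoopStr Q) (a : Q) : Prop :=
  (∀ x y, L.mul (L.mul a x) y = L.mul a (L.mul x y)) ∧
  (∀ x y, L.mul (L.mul x a) y = L.mul x (L.mul a y)) ∧
  (∀ x y, L.mul (L.mul x y) a = L.mul x (L.mul y a))

/-- Membership in the center `Z(Q) = C(Q) ∩ N(Q)`. -/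
def inCenter (L : LoopStr Q) (a : Q) : Prop :=
  (∀ x, L.mul a x = L.mul x a) ∧ L.inNucleus a

end LoopStr

/-- A cancellative unital magma `Q` whose conjugations `T x` and left inner mappings `l x y`
are realised in a commutative group `H` acting faithfully on `Q` by automorphisms. -/
structure InnerData (Q H : Type*) [MulOneClass Q] [IsCancelMul Q] [CommGroup H]
    [MulAction H Q] [FaithfulSMul H Q] where
  T : Q → H
  l : Q → Q → H
  smul_mul : ∀ (h : H) (x y : Q), h • (x * y) = (h • x) * (h • y)
  mul_T : ∀ x y : Q, y * (T y • x) = x * y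
  mul_l : ∀ x y z : Q, (x * y) * (l x y • z) = x * (y * z)
  exists_mul_left : ∀ y w : Q, ∃ z, y * z = w
  exists_mul_right : ∀ y w : Q, ∃ z, z * y = w

namespace InnerData

theorem inv_smul_of_smul {Q H : Type*} [CommGroup H] [MulAction H Q] {h : H} {x : Q}
    (hx : h • x = x) : h⁻¹ • x = x :=
  inv_smul_eq_iff.mpr hx.symm

variable {Q H : Type*} [MulOneClass Q] [IsCancelMul Q] [CommGroup H] [MulAction H Q]
  [FaithfulSMul H Q] (I : InnerData Q H)

theorem T_smul (h : H) (x : Q) : I.T (h • x) = I.T x := by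
  refine eq_of_smul_eq_smul fun u : Q => mul_left_cancel (a := h • x) ?_
  calc _ = u * (h • x) := I.mul_T _ _
    _ = h • ((h⁻¹ • u) * x) := by rw [I.smul_mul, smul_inv_smul]
    _ = h • (x * (I.T x • h⁻¹ • u)) := by rw [I.mul_T]
    _ = _ := by rw [I.smul_mul, smul_comm h (I.T x), smul_inv_smul]

theorem l_smul_smul (h : H) (x y : Q) : I.l (h • x) (h • y) = I.l x y := by
  refine eq_of_smul_eq_smul fun u : Q => mul_left_cancel (a := h • x * h • y) ?_
  calc _ = (h • x) * ((h • y) * u) := I.mul_l _ _ _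
    _ = h • (x * (y * h⁻¹ • u)) := by rw [I.smul_mul, I.smul_mul, smul_inv_smul]
    _ = h • ((x * y) * (I.l x y • h⁻¹ • u)) := by rw [I.mul_l]
    _ = _ := by rw [I.smul_mul, I.smul_mul, smul_comm h (I.l x y), smul_inv_smul]

theorem l_smul_left (h : H) (x y : Q) : I.l (h • x) y = I.l x (h⁻¹ • y) := by
  rw [← I.l_smul_smul h x, smul_inv_smul]

theorem l_smul_of_fix {h : H} {x : Q} (hx : h • x = x) (y : Q) : I.l x (h • y) = I.l x y := by
  conv_lhs => rw [← hx]
  exact I.l_smul_smul h x y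

theorem T_self (x : Q) : I.T x • x = x :=
  mul_left_cancel (I.mul_T x x)

theorem l_one_left (y : Q) : I.l 1 y = 1 := by
  refine eq_of_smul_eq_smul fun u : Q => mul_left_cancel (a := 1 * y) ?_
  rw [I.mul_l, one_mul, one_mul, one_smul]

/-- The element `c` with `(l x y)⁻¹ z · y = z · c y`. -/
def c (x z : Q) : H := (I.l x z)⁻¹ * I.l z (I.T z • x)

theorem mul_inv_l_smul (x y z : Q) : y * ((I.l x y)⁻¹ • z) = (I.c x z • y) * z := by
  apply mul_left_cancel (a := x)
  calc x * (y * ((I.l x y)⁻¹ • z)) = (x * y) * z := by rw [← I.mul_l, smul_inv_smul]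
    _ = z * ((I.T z • x) * (I.T z • y)) := by rw [← I.mul_T, I.smul_mul]
    _ = (x * z) * (I.l z (I.T z • x) • I.T z • y) := by rw [← I.mul_l, I.mul_T]
    _ = (x * z) * (I.l x z • I.T z • I.c x z • y) := by
      rw [smul_comm (I.l x z) (I.T z), c, mul_smul, smul_inv_smul, smul_comm (I.T z)]
    _ = x * ((I.c x z • y) * z) := by rw [I.mul_l, I.mul_T]

theorem inv_l_smul_mul (x y z : Q) : ((I.l x y)⁻¹ • z) * y = z * (I.c x z • y) := by
  apply smul_left_cancel (I.T z)
  rw [I.smul_mul, I.smul_mul, smul_comm (I.T z) (I.l x y)⁻¹, I.T_self, I.mul_T,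
    ← I.mul_inv_l_smul, ← I.mul_T y, I.T_smul]

theorem l_self (x y : Q) : I.l x y • x = x := by
  have h := I.inv_l_smul_mul x y x
  rw [c, I.T_self, inv_mul_cancel, one_smul] at h
  exact (inv_smul_eq_iff.mp (mul_right_cancel h)).symm

theorem T_mul_right (x y : Q) : I.T (x * y) • y = I.T x • y := by
  apply mul_left_cancel (a := x * y)
  calc _ = y * (x * y) := I.mul_T _ _
    _ = (y * x) * y := by rw [← I.mul_l, I.l_self]
    _ = y * ((I.T y • x) * (I.T x • y)) := by
      rw [← I.mul_T _ y, ← I.mul_T y x, I.smul_mul, smul_comm (I.T y) (I.T x), I.T_self]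
    _ = _ := by rw [← I.mul_l, I.mul_T, smul_comm, I.l_self]

theorem T_mul_left (x y : Q) : I.T (x * y) • x = I.T y • x := by
  apply mul_right_cancel (b := I.T x • y)
  calc _ = x * y := by rw [← I.T_mul_right x y, ← I.smul_mul, I.T_self]
    _ = _ := by
      apply mul_left_cancel (a := y)
      rw [← I.mul_l y (I.T y • x), I.mul_T x y, smul_comm, I.l_self, ← I.T_mul_right x y,
        I.mul_T y (x * y)]

theorem cocycle (x y z : Q) :
    I.l (x * y) (I.l x y • z) * I.l x y = I.l x (y * z) * I.l y z := by
  refine eq_of_smul_eq_smul fun u : Q => mul_left_cancel (a := x * (y * z)) ?_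
  rw [mul_smul, mul_smul, I.mul_l, ← I.mul_l x y z, I.mul_l, I.mul_l, ← I.mul_l x y,
    I.smul_mul]

theorem l_mul_smul_smul (x y z : Q) :
    I.l (x * y) (I.l x y • z) • I.l x y • y = I.l x (y * z) • y := by
  rw [smul_smul, cocycle, mul_smul, I.l_self]

theorem l_smul_smul_of_fix {k : H} {y : Q} (hy : k • y = y) (x w : Q) :
    I.l x (k • w) • y = I.l x w • y := by
  obtain ⟨z, rfl⟩ := I.exists_mul_left y w
  have key : ∀ z, (I.l y z • x) * ((I.l x y)⁻¹ • I.l x (y * z) • y) = x * y := fun z => by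
    have h := I.l_self (x * y) (I.l x y • z)
    rw [I.smul_mul] at h
    have hx : I.l (x * y) (I.l x y • z) • x = I.l y z • x := by
      rw [← I.l_self x y, ← mul_smul, I.l_self x y, cocycle, mul_comm, mul_smul, I.l_self]
    rwa [hx, ← inv_smul_smul (I.l x y) (I.l (x * y) (I.l x y • z) • y),
      smul_comm (I.l x y), I.l_mul_smul_smul] at h
  have h := (key (k • z)).trans (key z).symm
  rw [I.l_smul_of_fix hy] at h
  have h' := smul_left_cancel _ (mul_left_cancel h)
  rwa [I.smul_mul, hy]

theorem l_mul_smul_left (x y z : Q) : I.l (x * y) z • x = I.l y z • x := by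
  have h : I.l (x * y) (I.l x y • (I.l x y)⁻¹ • z) • I.l x y • x =
      I.l y ((I.l x y)⁻¹ • z) • x := by
    rw [smul_smul, cocycle, mul_comm, mul_smul, I.l_self]
  rw [smul_inv_smul, I.l_self] at h
  rw [h, I.l_smul_smul_of_fix (inv_smul_of_smul (I.l_self x y))]

theorem l_mul_smul_right (x y z : Q) : I.l (x * y) z • y = I.l x z • y := by
  rw [← I.mul_T, l_mul_smul_left, l_smul_left,
    I.l_smul_smul_of_fix (inv_smul_of_smul (I.T_self y))]

theorem l_smul_mul_l_smul (x y z : Q) : (I.l y z • x) * (I.l x z • y) = x * y := by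
  rw [← I.l_mul_smul_left x y, ← I.l_mul_smul_right x y, ← I.smul_mul, I.l_self]

theorem l_mul_right_smul_left (x y z : Q) :
    I.l x (y * z) • y = I.l x y • I.l x z • y := by
  rw [← l_mul_smul_smul, smul_comm, l_mul_smul_right, I.l_smul_of_fix (I.l_self x y)]

theorem l_mul_right_smul_right (x y z : Q) :
    I.l x (y * z) • z = I.l x y • I.l x z • z := by
  rw [← I.mul_T, l_mul_right_smul_left, I.l_smul_smul_of_fix (I.T_self z), smul_comm]

theorem l_smul_left_of_fix {h : H} {y : Q} (hy : h • y = y) (x : Q) :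
    I.l (h • x) y = I.l x y := by
  rw [l_smul_left, inv_smul_of_smul hy]

theorem l_ext_right {z w w' : Q} (h : ∀ y, I.l y w • z = I.l y w' • z) :
    I.l z w = I.l z w' := by
  refine eq_of_smul_eq_smul fun y : Q => mul_left_cancel (a := I.l y w • z) ?_
  rw [l_smul_mul_l_smul, h, l_smul_mul_l_smul]

theorem l_l_smul_smul (x u v w : Q) : I.l x (I.l u v • w) • v = I.l x w • v := by
  have hc : ∀ w, I.l x ((I.c u v)⁻¹ • w) • v = I.l x w • v := fun w => by
    have h := I.l_mul_smul_left ((I.l u x)⁻¹ • v) x w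
    rw [inv_l_smul_mul, smul_comm _ (I.l u x)⁻¹, smul_comm _ (I.l u x)⁻¹, l_mul_smul_left,
      l_smul_left] at h
    exact smul_left_cancel _ h
  have e : (I.c u v)⁻¹ • I.l v (I.T v • u) • w = I.l u v • w := by
    rw [c, smul_smul, mul_inv, inv_inv, inv_mul_cancel_right]
  rw [← e, hc, I.l_smul_smul_of_fix (I.l_self v _)]

theorem l_l_smul (k : H) (x u w : Q) : I.l x (I.l u (k • x) • w) = I.l x w := by
  have h : I.l u (k • x) = I.l (k⁻¹ • u) x := by rw [l_smul_left, inv_inv]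
  rw [h]
  exact I.l_ext_right fun y => I.l_l_smul_smul y _ x w

theorem l_c_smul (x z w : Q) : I.l x (I.c x z • w) = I.l x w := by
  rw [c, mul_smul, I.l_smul_of_fix (inv_smul_of_smul (I.l_self x z)), l_l_smul]

/-- `k` is tame if `l x (k y)` and `l x y` agree on `y`. -/
def Tame (k : H) : Prop := ∀ x y, I.l x (k • y) • y = I.l x y • y

theorem tame_of_exists {k : H}
    (h : ∀ y : Q, ∃ (u : Q) (g : H), k • u = u ∧ g • (y * u) = y * u ∧ g • y = k • y) :
    I.Tame k := fun x y => by
  obtain ⟨u, g, hu, hg, hgk⟩ := h y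
  have h₁ := I.l_smul_smul_of_fix hg x y
  rw [I.smul_mul, I.smul_mul, hgk, I.l_smul_smul_of_fix hu] at h₁
  exact mul_right_cancel h₁

theorem tame_T (u : Q) : I.Tame (I.T u) :=
  I.tame_of_exists fun y => ⟨u, I.T (y * u), I.T_self u, I.T_self _, I.T_mul_left y u⟩

theorem tame_l (u v : Q) : I.Tame (I.l u v) :=
  I.tame_of_exists fun y => ⟨u, I.l (y * u) v, I.l_self u v, I.l_self _ v, I.l_mul_smul_left y u v⟩

variable {I} in
theorem Tame.mul {g k : H} (hg : I.Tame g) (hk : I.Tame k) : I.Tame (g * k) := fun x y => by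
  have h := hg x (k • y)
  rw [smul_comm (I.l _ _) k, smul_comm (I.l _ _) k] at h
  have h' := smul_left_cancel k h
  rw [mul_smul, h', hk]

variable {I} in
theorem Tame.inv {k : H} (hk : I.Tame k) : I.Tame k⁻¹ := fun x y => by
  have h := hk x (k⁻¹ • y)
  rw [smul_inv_smul, smul_comm _ k⁻¹, smul_comm _ k⁻¹] at h
  exact (smul_left_cancel _ h).symm

/-- The discrepancy between `l x (k y)` and `l x y`. -/
def q (k : H) (x y : Q) : H := I.l x (k • y) * (I.l x y)⁻¹

theorem q_mul_l (k : H) (x y : Q) : I.q k x y * I.l x y = I.l x (k • y) :=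
  inv_mul_cancel_right _ _

theorem q_eq_one_iff {k : H} {x y : Q} : I.q k x y = 1 ↔ I.l x (k • y) = I.l x y :=
  mul_inv_eq_one

theorem q_smul_eq_iff {k : H} {x y z : Q} :
    I.q k x y • z = z ↔ I.l x (k • y) • z = I.l x y • z := by
  rw [q, mul_comm, mul_smul, inv_smul_eq_iff]

theorem q_eq_one_of_fix {k : H} {y : Q} (hy : k • y = y) (x : Q) : I.q k x y = 1 := by
  rw [q_eq_one_iff, hy]

theorem q_smul_of_fix {k : H} {z : Q} (hz : k • z = z) (x y : Q) : I.q k x y • z = z :=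
  I.q_smul_eq_iff.mpr (I.l_smul_smul_of_fix hz x y)

theorem q_congr {k k' : H} {y : Q} (h : k • y = k' • y) (x : Q) : I.q k x y = I.q k' x y := by
  rw [q, q, h]

theorem q_smul_left (k : H) (x y : Q) : I.q k x y • x = x :=
  I.q_smul_eq_iff.mpr (by rw [l_self, l_self])

theorem q_smul_smul (k h : H) (x y : Q) : I.q k (h • x) (h • y) = I.q k x y := by
  rw [q, smul_comm k h, l_smul_smul, l_smul_smul, q]

theorem q_mul (g k : H) (x y : Q) : I.q (g * k) x y = I.q g x (k • y) * I.q k x y := by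
  simp [q, mul_smul]

theorem q_inv (k : H) (x y : Q) : I.q k⁻¹ x y = (I.q k x (k⁻¹ • y))⁻¹ := by
  simp [q]

theorem q_skew (k : H) (x y z : Q) : ((I.q k z y)⁻¹ • x) * z = x * (I.q k x y • z) := by
  have hx : I.q k z y • x = (I.l x y)⁻¹ • (I.l z y)⁻¹ • I.l z (k • y) • x := by
    conv_lhs => rw [← inv_smul_of_smul (I.l_self x y)]
    simp only [q, smul_smul]
    congr 1
    ac_rfl
  have hz : I.q k x y • z = (I.l x y)⁻¹ • (I.l z y)⁻¹ • I.l x (k • y) • z := by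
    conv_lhs => rw [← inv_smul_of_smul (I.l_self z y)]
    simp only [q, smul_smul]
    congr 1
    ac_rfl
  have h : (I.q k z y • x) * (I.q k x y • z) = x * z := by
    rw [hx, hz, ← I.smul_mul, ← I.smul_mul, l_smul_mul_l_smul, inv_smul_eq_iff,
      inv_smul_eq_iff, I.smul_mul, I.smul_mul, I.l_self, smul_comm (I.l z y), I.l_self,
      l_smul_mul_l_smul]
  apply smul_left_cancel (I.q k z y)
  rw [I.smul_mul, I.smul_mul, smul_inv_smul, smul_comm (I.q k z y) (I.q k x y), q_smul_left, h]

variable {I} in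
theorem Tame.q_smul_right {k : H} (hk : I.Tame k) (x y : Q) : I.q k x y • y = y :=
  I.q_smul_eq_iff.mpr (hk x y)

variable {I} in
theorem Tame.q_self {k : H} (hk : I.Tame k) (x : Q) : I.q k x x = 1 :=
  I.q_eq_one_iff.mpr (I.l_ext_right fun y => hk y x)

variable {I} in
theorem Tame.inv_q_smul_mul {k : H} (hk : I.Tame k) (x y z : Q) :
    ((I.q k x y)⁻¹ • z) * y = z * (((I.q k x z)⁻¹ * I.q k⁻¹ z (I.T z • x)) • y) := by
  obtain ⟨y, rfl⟩ : ∃ w, I.c x z • w = y := ⟨_, smul_inv_smul _ y⟩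
  have hc : I.c (k⁻¹ • x) z = (I.q k x z)⁻¹ * I.q k⁻¹ z (I.T z • x) * I.c x z := by
    rw [c, l_smul_left, inv_inv, smul_comm, ← q_mul_l, ← q_mul_l, c, mul_inv]
    ac_rfl
  have hq : I.q k x (I.c x z • y) = I.q k x y := by
    rw [q, smul_comm, l_c_smul, l_c_smul, q]
  have h := I.inv_l_smul_mul (k⁻¹ • x) y z
  rw [hc, mul_smul, l_smul_left, inv_inv, ← q_mul_l, mul_inv, mul_smul] at h
  rw [← h, hq]
  apply smul_left_cancel (I.q k x y)
  rw [I.smul_mul, I.smul_mul, smul_inv_smul, smul_inv_smul, smul_comm, hk.q_smul_right,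
    inv_l_smul_mul]

theorem twisted_mul (I : InnerData Q H) {A B c : H} {y y' z : Q} (hA : (A • z) * y = z * (c • y))
    (hB : (B • z) * y' = z * (c • y')) (hAy : A • y = y) (hAy' : A • y' = y')
    (hBy' : B • y' = y') (hcz : c • z = z) :
    ((A * B) • z) * (y' * y) = z * (c • (y' * y)) := by
  have h₁ : I.l ((A * B) • z) y' = I.l z y' :=
    I.l_smul_left_of_fix (by rw [mul_smul, hBy', hAy']) z
  have h₂ : I.l (A • z) (c • y') = I.l z y' := by
    rw [I.l_smul_left_of_fix (by rw [smul_comm, hAy']), I.l_smul_of_fix hcz]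
  have h₃ : I.l (A • z) y = I.l z (c • y) := by
    rw [I.l_smul_left_of_fix hAy, I.l_smul_of_fix hcz]
  calc _ = (A • ((B • z) * y')) * (I.l z y' • y) := by
        rw [← I.mul_l, h₁, mul_smul, I.smul_mul, hAy']
    _ = (A • z) * (y * (I.T y • c • y')) := by
        rw [hB, I.smul_mul, smul_comm, hAy', ← h₂, I.mul_l, I.mul_T]
    _ = z * ((c • y) * (I.T (c • y) • c • y')) := by
        rw [← I.mul_l, h₃, hA, I.mul_l, I.T_smul]
    _ = _ := by rw [I.mul_T, I.smul_mul]

variable {I} in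
theorem Tame.q_mul_right {k : H} (hk : I.Tame k) {x y y' : Q} (h : I.q k x y • y' = y') :
    I.q k x (y' * y) = I.q k x y * I.q k x y' := by
  rw [← inv_inj, mul_inv]
  refine eq_of_smul_eq_smul fun z : Q => mul_right_cancel (b := y' * y) ?_
  rw [hk.inv_q_smul_mul]
  refine (I.twisted_mul (hk.inv_q_smul_mul x y z) (hk.inv_q_smul_mul x y' z)
    (inv_smul_of_smul (hk.q_smul_right x y)) (inv_smul_of_smul h)
    (inv_smul_of_smul (hk.q_smul_right x y')) ?_).symm
  rw [mul_smul, q_smul_left, inv_smul_of_smul (hk.q_smul_right x z)]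

theorem q_mul_left {k : H} {t t' y : Q} (h : I.q k t y • t' = t') :
    I.q k (t' * t) y = I.q k t y * I.q k t' y := by
  rw [← inv_inj, mul_inv]
  refine eq_of_smul_eq_smul fun x : Q => mul_right_cancel (b := t' * t) ?_
  rw [q_skew]
  exact (I.twisted_mul (I.q_skew k x y t) (I.q_skew k x y t')
    (inv_smul_of_smul (I.q_smul_left k t y)) (inv_smul_of_smul h)
    (inv_smul_of_smul (I.q_smul_left k t' y)) (I.q_smul_left k x y)).symm

variable {I} in
theorem Tame.q_mul_q_swap {k : H} (hk : I.Tame k) (x z : Q) : I.q k x z * I.q k z x = 1 := by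
  have h₁ : I.q k z (x * z) = I.q k z x := by
    rw [hk.q_mul_right (by rw [hk.q_self, one_smul]), hk.q_self, one_mul]
  have h₂ : I.q k x (x * z) = I.q k x z := by
    rw [hk.q_mul_right (I.q_smul_left k x z), hk.q_self, mul_one]
  rw [← hk.q_self (x * z), q_mul_left, h₁, h₂, mul_comm]
  rw [h₁, hk.q_smul_right]

variable {I} in
theorem Tame.q_eq_one {k : H} (hk : I.Tame k) (h : ∀ x y, I.q k x (k • y) = I.q k x y)
    (x y : Q) : I.q k x y = 1 := by
  rw [← inv_eq_one]
  refine eq_of_smul_eq_smul fun z : Q => mul_right_cancel (b := y) ?_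
  have hz : I.q k⁻¹ z (I.T z • x) = I.q k x z := by
    rw [q_inv, ← h, smul_inv_smul, ← eq_inv_of_mul_eq_one_left (hk.q_mul_q_swap _ z)]
    conv_lhs => rw [← I.T_self z, T_smul]
    exact I.q_smul_smul k _ x z
  rw [hk.inv_q_smul_mul, hz, inv_mul_cancel, one_smul, one_smul]

theorem q_T_mul_q_T (u v x : Q) : I.q (I.T u) x v * I.q (I.T v) x u = 1 := by
  have h₁ := I.q_congr (I.T_mul_right u v) x
  rw [← I.q_eq_one_of_fix (I.T_self (u * v)) x, (I.tame_T _).q_mul_right, h₁,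
    I.q_congr (I.T_mul_left u v)]
  rw [h₁, I.q_smul_of_fix (I.T_self u)]

theorem q_T (u x y : Q) : I.q (I.T u) x y = 1 :=
  (I.tame_T u).q_eq_one (fun x y => by
    rw [eq_inv_of_mul_eq_one_left (I.q_T_mul_q_T u (I.T u • y) x), T_smul,
      ← eq_inv_of_mul_eq_one_left (I.q_T_mul_q_T u y x)]) x y

theorem q_l_right (u v x : Q) : I.q (I.l u v) x v = I.q (I.l v v)⁻¹ x u := by
  have h₁ : I.l u v • (u * v) = (I.l v v)⁻¹ • (u * v) := by
    rw [eq_inv_smul_iff, I.smul_mul, I.smul_mul, I.l_self, smul_comm, I.l_self,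
      l_smul_mul_l_smul]
  have hv := inv_smul_of_smul (I.l_self v v)
  have h₂ := I.q_congr h₁ x
  rwa [(I.tame_l u v).q_mul_right (I.q_smul_of_fix (I.l_self u v) x v),
    (I.tame_l v v).inv.q_mul_right (by rw [I.q_eq_one_of_fix hv, one_smul]),
    I.q_eq_one_of_fix hv, I.q_eq_one_of_fix (I.l_self u v), mul_one, one_mul] at h₂

theorem q_l_right_eq_one (u v x : Q) : I.q (I.l u v) x v = 1 := by
  rw [q_l_right]
  refine (I.tame_l v v).inv.q_eq_one (fun x y => ?_) x u
  rw [← q_l_right, I.l_smul_left_of_fix (inv_smul_of_smul (I.l_self v v)), q_l_right]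

theorem q_l_mul_q_l (u v x y : Q) : I.q (I.l u v) x y * I.q (I.l u y) x v = 1 := by
  have h₀ : ∀ v y, I.q (I.l u v * I.l u y) x v = I.q (I.l u y) x v := fun v y => by
    have h := I.q_l_right_eq_one u (I.l u y • v) x
    rw [I.l_smul_of_fix (I.l_self u y)] at h
    rw [q_mul, h, one_mul]
  have h₁ : (I.l u v * I.l u y) • (v * y) = I.l u (v * y) • (v * y) := by
    rw [I.smul_mul, I.smul_mul, l_mul_right_smul_left, l_mul_right_smul_right, mul_smul,
      mul_smul]
  have h₂ : I.q (I.l u v * I.l u y) x y = I.q (I.l u v) x y := by rw [mul_comm, h₀]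
  rw [← I.q_l_right_eq_one u (v * y) x, ← I.q_congr h₁,
    ((I.tame_l u v).mul (I.tame_l u y)).q_mul_right, h₀, h₂]
  rw [h₂, q_smul_eq_iff, l_l_smul_smul]

theorem q_l (u v x y : Q) : I.q (I.l u v) x y = 1 :=
  (I.tame_l u v).q_eq_one (fun x y => by
    rw [eq_inv_of_mul_eq_one_left (I.q_l_mul_q_l u v x (I.l u v • y)),
      I.l_smul_of_fix (I.l_self u v),
      ← eq_inv_of_mul_eq_one_left (I.q_l_mul_q_l u v x y)]) x y

theorem l_T_smul (u x y : Q) : I.l x (I.T u • y) = I.l x y :=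
  I.q_eq_one_iff.mp (I.q_T u x y)

theorem l_l_smul_right (u v x y : Q) : I.l x (I.l u v • y) = I.l x y :=
  I.q_eq_one_iff.mp (I.q_l u v x y)

/-- The conditions `l u v • a = a`, `l u a = 1` and `l a v = 1` on `a` say that it lies in the
right, middle and left nucleus. -/
structure IsNuclear (a : Q) : Prop where
  l_smul : ∀ u v, I.l u v • a = a
  l_right : ∀ u, I.l u a = 1
  l_left : ∀ v, I.l a v = 1

theorem isNuclear_of_l_mul {a x : Q} (ha : ∀ u v, I.l u v • a = a)
    (hr : ∀ u, I.l u (x * a) = I.l u x) (hl : ∀ v, I.l (x * a) v = I.l x v) :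
    I.IsNuclear a := by
  have cancel : ∀ u, I.l (u * x) a = I.l x a := fun u => by
    have h := I.cocycle u x a
    rw [ha, hr, mul_comm] at h
    exact mul_left_cancel h
  have hxa : I.l x a = 1 := by
    obtain ⟨u, hu⟩ := I.exists_mul_right x 1
    rw [← cancel u, hu, l_one_left]
  have right : ∀ w, I.l w a = 1 := fun w => by
    obtain ⟨u, rfl⟩ := I.exists_mul_right x w
    rw [cancel, hxa]
  refine ⟨ha, right, fun z => ?_⟩
  have hz : ∀ w, I.l w (I.T z • a) = 1 := fun w => by
    rw [← right ((I.T z)⁻¹ • w), l_smul_left, inv_inv]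
  have h₁ := I.cocycle x z (I.T z • a)
  rw [smul_comm, ha, hz, hz, one_mul, mul_one, I.mul_T] at h₁
  have h₂ := I.cocycle x a z
  rw [hxa, one_smul, hl, mul_one, ← h₁] at h₂
  exact mul_eq_left.mp h₂.symm

theorem smul_displacement {k : H} (hk : ∀ x y, I.l x (k • y) = I.l x y) {a x y z : Q}
    (ha : z * a = (I.l x y)⁻¹ • z) : k • a = a := by
  have h : ∀ y', I.l x y' = I.l x y → a * ((I.l z a)⁻¹ • y') = I.c x z • y' := fun y' hy' => by
    apply mul_left_cancel (a := z)
    rw [← I.mul_l, smul_inv_smul, ha, ← hy', inv_l_smul_mul]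
  have h₁ := h _ (hk x y)
  rw [smul_comm _ k, smul_comm _ k, ← h y rfl, I.smul_mul] at h₁
  exact (mul_right_cancel h₁).symm

theorem isNuclear_displacement {a x y z : Q} (ha : z * a = (I.l x y)⁻¹ • z) :
    I.IsNuclear a :=
  I.isNuclear_of_l_mul (fun u v => I.smul_displacement (I.l_l_smul_right u v) ha)
    (fun u => by
      rw [ha, ← I.l_l_smul_right x y, smul_inv_smul])
    (fun v => by
      rw [ha, l_smul_left, inv_inv, l_l_smul_right])

theorem T_smul_displacement {a x y z : Q} (ha : z * a = (I.l x y)⁻¹ • z) (u : Q) :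
    I.T u • a = a :=
  I.smul_displacement (I.l_T_smul u) ha

theorem displacement_of_associator {a x y z : Q} (ha : (x * (y * z)) * a = (x * y) * z) :
    (I.l x y • z) * a = (I.l x y)⁻¹ • I.l x y • z := by
  obtain ⟨a', ha'⟩ := I.exists_mul_left (I.l x y • z) ((I.l x y)⁻¹ • I.l x y • z)
  have h := I.mul_l (x * y) (I.l x y • z) a'
  rw [(I.isNuclear_displacement ha').l_smul, ha', inv_smul_smul, I.mul_l, ← ha] at h
  rw [← mul_left_cancel h, ha']

theorem inv_l_smul_eq_of_mul_eq_T_smul {b x y : Q} (hb : x * b = I.T y • x) (u v : Q) :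
    (I.l u v)⁻¹ • b = b := by
  obtain ⟨a, ha⟩ := I.exists_mul_left x ((I.l u v)⁻¹ • x)
  have hn := I.isNuclear_displacement ha
  have hT := I.T_smul_displacement ha
  set b' := (I.l u v)⁻¹ • b with hb'
  have h₁ : (x * a) * b' = (x * b) * a := by
    rw [ha, hb', ← I.smul_mul, hb, smul_comm, ← ha, I.smul_mul, hT]
  have h₂ : (x * a) * b' = (x * b') * a := by
    have e : (x * a) * b' = x * (a * b') := by rw [← I.mul_l, hn.l_right, one_smul]
    rw [e, ← I.mul_T a b', hT, ← I.mul_l, hn.l_smul]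
  exact mul_left_cancel (mul_right_cancel (h₂.symm.trans h₁))

theorem isNuclear_of_commutator {b x y : Q} (hb : (y * x) * b = x * y) : I.IsNuclear b := by
  obtain ⟨b', hb'⟩ := I.exists_mul_left x (I.T y • x)
  have hl : ∀ u v, I.l u v • b' = b' := fun u v =>
    (inv_smul_eq_iff.mp (I.inv_l_smul_eq_of_mul_eq_T_smul hb' u v)).symm
  obtain rfl : b = b' := by
    rw [← hl y x]
    apply mul_left_cancel (a := y * x)
    rw [hb, I.mul_l, hb', I.mul_T]
  refine I.isNuclear_of_l_mul (x := x) hl (fun u => ?_) (fun v => ?_)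
  · rw [hb', l_T_smul]
  · rw [hb', ← I.l_T_smul y, l_smul_smul]

theorem IsNuclear.mul_mul_left {I : InnerData Q H} {a : Q} (ha : I.IsNuclear a) (x y : Q) :
    (a * x) * y = a * (x * y) := by
  rw [← I.mul_l, ha.l_left, one_smul]

theorem IsNuclear.mul_mul_mid {I : InnerData Q H} {a : Q} (ha : I.IsNuclear a) (x y : Q) :
    (x * a) * y = x * (a * y) := by
  rw [← I.mul_l, ha.l_right, one_smul]

theorem IsNuclear.mul_mul_right {I : InnerData Q H} {a : Q} (ha : I.IsNuclear a) (x y : Q) :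
    (x * y) * a = x * (y * a) := by
  rw [← I.mul_l, ha.l_smul]

theorem isNuclear_of_associator {a x y z : Q} (ha : (x * (y * z)) * a = (x * y) * z) :
    I.IsNuclear a :=
  I.isNuclear_displacement (I.displacement_of_associator ha)

theorem mul_comm_of_associator (I : InnerData Q H) {a x y z : Q}
    (ha : (x * (y * z)) * a = (x * y) * z) (u : Q) :
    a * u = u * a := by
  rw [← I.mul_T a u, I.T_smul_displacement (I.displacement_of_associator ha)]

end InnerData

namespace LoopStr

variable {Q : Type*} (L : LoopStr Q)

/-- The multiplication of a loop as a unital magma. -/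
abbrev toMulOneClass : MulOneClass Q where
  mul := L.mul
  one := L.one
  one_mul := L.one_mul
  mul_one := L.mul_one

theorem mul_left_injective {x y z : Q} (h : L.mul x y = L.mul x z) : y = z := by
  rw [← L.ld_mul x y, h, L.ld_mul]

theorem mul_right_injective {x y z : Q} (h : L.mul x z = L.mul y z) : x = y := by
  rw [← L.rd_mul x z, h, L.rd_mul]

theorem ld_self (x : Q) : L.ld x x = L.one := by
  have h := L.ld_mul x L.one
  rwa [L.mul_one] at h

/-- Conjugation by `x` as a permutation. -/
def conjPerm (x : Q) : Equiv.Perm Q where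
  toFun u := L.Tm u x
  invFun u := L.rd (L.mul x u) x
  left_inv u := by simp only [Tm, L.mul_ld, L.rd_mul]
  right_inv u := by simp only [Tm, L.mul_rd, L.ld_mul]

/-- The left inner mapping determined by `x` and `y` as a permutation. -/
def leftPerm (x y : Q) : Equiv.Perm Q where
  toFun z := L.Lm z y x
  invFun z := L.ld y (L.ld x (L.mul (L.mul x y) z))
  left_inv z := by simp only [Lm, L.mul_ld, L.ld_mul]
  right_inv z := by simp only [Lm, L.mul_ld, L.ld_mul]

/-- The conjugations and left inner mappings of a loop. -/
def innerGenerators : Set (Equiv.Perm Q) :=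
  Set.range L.conjPerm ∪ Set.range fun p : Q × Q => L.leftPerm p.1 p.2

theorem innerGenerators_comm (hAIM : L.IsAIM) :
    ∀ f ∈ L.innerGenerators, ∀ g ∈ L.innerGenerators, f * g = g * f := by
  obtain ⟨hTT, hLL, -, hTL, -⟩ := hAIM
  rintro _ (⟨x, rfl⟩ | ⟨⟨x, y⟩, rfl⟩) _ (⟨z, rfl⟩ | ⟨⟨z, w⟩, rfl⟩) <;> ext u
  · exact hTT u z x
  · exact hTL u w z x
  · exact (hTL u y x z).symm
  · exact hLL u w z y x

theorem apply_mul_of_mem_closure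
    (hT : ∀ u v x, L.Tm (L.mul u v) x = L.mul (L.Tm u x) (L.Tm v x))
    (hL : ∀ u v x y, L.Lm (L.mul u v) x y = L.mul (L.Lm u x y) (L.Lm v x y))
    {f : Equiv.Perm Q} (hf : f ∈ Subgroup.closure L.innerGenerators) (u v : Q) :
    f (L.mul u v) = L.mul (f u) (f v) := by
  induction hf using Subgroup.closure_induction generalizing u v with
  | mem f hf =>
    obtain ⟨x, rfl⟩ | ⟨⟨x, y⟩, rfl⟩ := hf
    · exact hT u v x
    · exact hL u v y x
  | one => rfl
  | mul f g _ _ hf hg => rw [Equiv.Perm.mul_apply, hg, hf]; rfl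
  | inv f _ hf =>
    apply f.injective
    rw [hf]
    simp

theorem comm_eq_one {x y : Q} (h : L.mul x y = L.mul y x) : L.comm x y = L.one := by
  rw [comm, h, ld_self]

theorem assoc_eq_one {x y z : Q} (h : L.mul (L.mul x y) z = L.mul x (L.mul y z)) :
    L.assoc x y z = L.one := by
  rw [assoc, h, ld_self]

end LoopStr

/-- In an AIM automorphic loop, associators and commutators lie in the nucleus,
and associators lie in the commutant. -/
theorem aim_automorphic_main {Q : Type*} (L : LoopStr Q)
    (hT : ∀ u v x, L.Tm (L.mul u v) x = L.mul (L.Tm u x) (L.Tm v x))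
    (hL : ∀ u v x y, L.Lm (L.mul u v) x y = L.mul (L.Lm u x y) (L.Lm v x y))
    (hR : ∀ u v x y, L.Rm (L.mul u v) x y = L.mul (L.Rm u x y) (L.Rm v x y))
    (hAIM : L.IsAIM) :
    (∀ x y z u v,
      L.assoc (L.assoc x y z) u v = L.one ∧
      L.assoc u (L.assoc x y z) v = L.one ∧
      L.assoc u v (L.assoc x y z) = L.one) ∧
    (∀ x y z u,
      L.assoc (L.comm x y) z u = L.one ∧
      L.assoc z (L.comm x y) u = L.one ∧
      L.assoc z u (L.comm x y) = L.one) ∧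
    (∀ x y z u, L.comm (L.assoc x y z) u = L.one) := by
  let := L.toMulOneClass
  have : IsCancelMul Q :=
    { mul_left_cancel := fun _ _ _ h => L.mul_left_injective h
      mul_right_cancel := fun _ _ _ h => L.mul_right_injective h }
  have : IsMulCommutative (Subgroup.closure L.innerGenerators) :=
    Subgroup.isMulCommutative_closure (L.innerGenerators_comm hAIM)
  open scoped IsMulCommutative in
  let I : InnerData Q (Subgroup.closure L.innerGenerators) :=
    { T := fun x => ⟨L.conjPerm x, Subgroup.subset_closure (.inl ⟨x, rfl⟩)⟩
      l := fun x y => ⟨L.leftPerm x y, Subgroup.subset_closure (.inr ⟨(x, y), rfl⟩)⟩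
      smul_mul := fun f => L.apply_mul_of_mem_closure hT hL f.2
      mul_T := fun _ _ => L.mul_ld _ _
      mul_l := fun _ _ _ => L.mul_ld _ _
      exists_mul_left := fun y w => ⟨L.ld y w, L.mul_ld y w⟩
      exists_mul_right := fun y w => ⟨L.rd w y, L.mul_rd w y⟩ }
  have hassoc : ∀ x y z, I.IsNuclear (L.assoc x y z) := fun _ _ _ =>
    I.isNuclear_of_associator (L.mul_ld _ _)
  have hcomm : ∀ x y, I.IsNuclear (L.comm x y) := fun _ _ =>
    I.isNuclear_of_commutator (L.mul_ld _ _)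
  have key : ∀ a, I.IsNuclear a → ∀ u v,
      L.assoc a u v = L.one ∧ L.assoc u a v = L.one ∧ L.assoc u v a = L.one :=
    fun a ha u v => ⟨L.assoc_eq_one (ha.mul_mul_left u v), L.assoc_eq_one (ha.mul_mul_mid u v),
      L.assoc_eq_one (ha.mul_mul_right u v)⟩
  exact ⟨fun x y z u v => key _ (hassoc x y z) u v, fun x y z u => key _ (hcomm x y) z u,
    fun x y z u => L.comm_eq_one (I.mul_comm_of_associator (L.mul_ld _ _) u)⟩
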